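/- arXiv:1603.04950 — 3 statements merged into one kernel-verified Lean document; each statement's English description precedes it below -/
import Mathlib

section
/- Let T ∈ ℂ^{2n×2n} be an invertible doubled-up matrix, let F ∈ ℂ^{2n×2n} be doubled-up, and set Θ := T J_n T†. Then the matrix M := (i/2)(Θ^{−1}F − F†Θ^{−1}) is Hermitian and doubled-up, i.e. M† = M and MΣ_n = Σ_n M^#. -/
open Matrix

noncomputable section

/-- `J_k = [[I, 0],[0, −I]]`. -/
def Jmat (k : ℕ) : Matrix (Fin k ⊕ Fin k) (Fin k ⊕ Fin k) ℂ :=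
  Matrix.fromBlocks 1 0 0 (-1)

/-- `Σ_k = [[0, I],[I, 0]]`. -/
def SigmaMat (k : ℕ) : Matrix (Fin k ⊕ Fin k) (Fin k ⊕ Fin k) ℂ :=
  Matrix.fromBlocks 0 1 1 0

/-- Entrywise complex conjugate of a matrix. -/
def conjMat {α β : Type*} (R : Matrix α β ℂ) : Matrix α β ℂ :=
  R.map (starRingEnd ℂ)

/-- `R ∈ ℂ^{2n×2m}` is doubled-up if `R Σ_m = Σ_n R^#`. -/
def DoubledUp {n m : ℕ} (R : Matrix (Fin n ⊕ Fin n) (Fin m ⊕ Fin m) ℂ) : Prop :=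
  R * SigmaMat m = SigmaMat n * conjMat R

/-- The matrix `M := (i/2)(Θ⁻¹ F − F† Θ⁻¹)` where `Θ := T J_n T†`. -/
def Mmat {n : ℕ} (T F : Matrix (Fin n ⊕ Fin n) (Fin n ⊕ Fin n) ℂ) :
    Matrix (Fin n ⊕ Fin n) (Fin n ⊕ Fin n) ℂ :=
  (Complex.I / 2) •
    ((T * Jmat n * Tᴴ)⁻¹ * F - Fᴴ * (T * Jmat n * Tᴴ)⁻¹)

theorem conjMat_mul {α β γ : Type*} [Fintype β] (A : Matrix α β ℂ) (B : Matrix β γ ℂ) :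
    conjMat (A * B) = conjMat A * conjMat B :=
  Matrix.map_mul

theorem SigmaMat_mul_self (k : ℕ) : SigmaMat k * SigmaMat k = 1 := by
  simp [SigmaMat, Matrix.fromBlocks_multiply]

theorem Jmat_mul_self (k : ℕ) : Jmat k * Jmat k = 1 := by
  simp [Jmat, Matrix.fromBlocks_multiply]

theorem conjTranspose_SigmaMat (k : ℕ) : (SigmaMat k)ᴴ = SigmaMat k := by
  simp [SigmaMat, Matrix.fromBlocks_conjTranspose]

theorem conjTranspose_Jmat (k : ℕ) : (Jmat k)ᴴ = Jmat k := by
  simp [Jmat, Matrix.fromBlocks_conjTranspose]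

theorem conjMat_Jmat (k : ℕ) : conjMat (Jmat k) = Jmat k := by
  ext i j
  rcases i with i | i <;> rcases j with j | j <;>
    simp [conjMat, Jmat, Matrix.one_apply, apply_ite]

theorem Jmat_mul_SigmaMat (k : ℕ) : Jmat k * SigmaMat k = -(SigmaMat k * Jmat k) := by
  simp [Jmat, SigmaMat, Matrix.fromBlocks_multiply, Matrix.fromBlocks_neg]

theorem conjMat_one (α : Type*) [DecidableEq α] : conjMat (1 : Matrix α α ℂ) = 1 :=
  Matrix.map_one _ (map_zero _) (map_one _)

theorem DoubledUp.conjTranspose {n m : ℕ} {R : Matrix (Fin n ⊕ Fin n) (Fin m ⊕ Fin m) ℂ}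
    (h : DoubledUp R) : DoubledUp Rᴴ := by
  have h1 : SigmaMat m * Rᴴ = conjMat Rᴴ * SigmaMat n := by
    have h2 := congrArg Matrix.conjTranspose (show R * SigmaMat m = SigmaMat n * conjMat R from h)
    rw [Matrix.conjTranspose_mul, Matrix.conjTranspose_mul, conjTranspose_SigmaMat,
      conjTranspose_SigmaMat] at h2
    exact h2
  calc Rᴴ * SigmaMat n
      = SigmaMat m * (SigmaMat m * Rᴴ) * SigmaMat n := by
        rw [← Matrix.mul_assoc (SigmaMat m), SigmaMat_mul_self, Matrix.one_mul]
    _ = SigmaMat m * conjMat Rᴴ := by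
        rw [h1, Matrix.mul_assoc, Matrix.mul_assoc, SigmaMat_mul_self, Matrix.mul_one]

/-- `T J T†` anticommutes with `Σ` up to entrywise conjugation when `T` is doubled-up. -/
theorem DoubledUp.mul_Jmat_mul_conjTranspose_mul_SigmaMat {n m : ℕ}
    {T : Matrix (Fin n ⊕ Fin n) (Fin m ⊕ Fin m) ℂ} (h : DoubledUp T) :
    T * Jmat m * Tᴴ * SigmaMat n = -(SigmaMat n * conjMat (T * Jmat m * Tᴴ)) := by
  have h1 : T * SigmaMat m = SigmaMat n * conjMat T := h
  have h2 : Tᴴ * SigmaMat n = SigmaMat m * conjMat Tᴴ := h.conjTranspose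
  rw [Matrix.mul_assoc, h2, ← Matrix.mul_assoc, Matrix.mul_assoc T, Jmat_mul_SigmaMat,
    Matrix.mul_neg, ← Matrix.mul_assoc, h1, conjMat_mul, conjMat_mul, conjMat_Jmat]
  simp only [Matrix.neg_mul, Matrix.mul_assoc]

theorem inv_mul_SigmaMat_of_mul_SigmaMat {n : ℕ} {A : Matrix (Fin n ⊕ Fin n) (Fin n ⊕ Fin n) ℂ}
    (hA : IsUnit A) (h : A * SigmaMat n = -(SigmaMat n * conjMat A)) :
    A⁻¹ * SigmaMat n = -(SigmaMat n * conjMat A⁻¹) := by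
  have hdet := (Matrix.isUnit_iff_isUnit_det A).1 hA
  have hc : conjMat A * conjMat A⁻¹ = 1 := by
    rw [← conjMat_mul, Matrix.mul_nonsing_inv A hdet, conjMat_one]
  calc A⁻¹ * SigmaMat n
      = A⁻¹ * (SigmaMat n * conjMat A) * conjMat A⁻¹ := by
        rw [Matrix.mul_assoc, Matrix.mul_assoc, hc, Matrix.mul_one]
    _ = -(SigmaMat n * conjMat A⁻¹) := by
        rw [← neg_eq_iff_eq_neg.2 h, Matrix.mul_neg, ← Matrix.mul_assoc,
          Matrix.nonsing_inv_mul A hdet, Matrix.one_mul, Matrix.neg_mul]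

/-- for invertible doubled-up `T` and doubled-up `F`, with `Θ := T J_n T†`,
the matrix `M := (i/2)(Θ⁻¹ F − F† Θ⁻¹)` is Hermitian and doubled-up. -/
theorem stmt3 (n : ℕ) (hn : 0 < n)
    (T F : Matrix (Fin n ⊕ Fin n) (Fin n ⊕ Fin n) ℂ)
    (hT : IsUnit T) (hTd : DoubledUp T) (hFd : DoubledUp F) :
    (Mmat T F)ᴴ = Mmat T F ∧
      Mmat T F * SigmaMat n = SigmaMat n * conjMat (Mmat T F) := by
  set Θ := T * Jmat n * Tᴴ with hΘ
  have hJ : IsUnit (Jmat n) := IsUnit.of_mul_eq_one _ (Jmat_mul_self n)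
  have hTu : IsUnit Θ := (hT.mul hJ).mul hT.star
  have hΘH : Θᴴ = Θ := by
    simp [hΘ, Matrix.conjTranspose_mul, conjTranspose_Jmat, Matrix.mul_assoc]
  have hinvH : (Θ⁻¹)ᴴ = Θ⁻¹ := by rw [Matrix.conjTranspose_nonsing_inv, hΘH]
  have hM : Mmat T F = (Complex.I / 2) • (Θ⁻¹ * F - Fᴴ * Θ⁻¹) := rfl
  rw [hM]
  constructor
  · rw [Matrix.conjTranspose_smul, Matrix.conjTranspose_sub, Matrix.conjTranspose_mul,
      Matrix.conjTranspose_mul, hinvH, Matrix.conjTranspose_conjTranspose,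
      ← neg_sub (Θ⁻¹ * F), smul_neg, ← neg_smul]
    congr 1
    simp [neg_div]
  · have hinv : Θ⁻¹ * SigmaMat n = -(SigmaMat n * conjMat Θ⁻¹) :=
      inv_mul_SigmaMat_of_mul_SigmaMat hTu hTd.mul_Jmat_mul_conjTranspose_mul_SigmaMat
    have hF : F * SigmaMat n = SigmaMat n * conjMat F := hFd
    have hF' : Fᴴ * SigmaMat n = SigmaMat n * conjMat Fᴴ := hFd.conjTranspose
    have hc : conjMat ((Complex.I / 2) • (Θ⁻¹ * F - Fᴴ * Θ⁻¹)) =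
        -((Complex.I / 2) • (conjMat Θ⁻¹ * conjMat F - conjMat Fᴴ * conjMat Θ⁻¹)) := by
      rw [← conjMat_mul, ← conjMat_mul]
      ext i j
      simp only [conjMat, Matrix.map_apply, Matrix.smul_apply, Matrix.sub_apply,
        Matrix.neg_apply, smul_eq_mul, map_mul, map_sub, map_div₀, Complex.conj_I, map_ofNat]
      ring
    have h1 : Θ⁻¹ * F * SigmaMat n = -(SigmaMat n * (conjMat Θ⁻¹ * conjMat F)) := by
      rw [Matrix.mul_assoc, hF, ← Matrix.mul_assoc, hinv, Matrix.neg_mul, Matrix.mul_assoc]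
    have h2 : Fᴴ * Θ⁻¹ * SigmaMat n = -(SigmaMat n * (conjMat Fᴴ * conjMat Θ⁻¹)) := by
      rw [Matrix.mul_assoc, hinv, Matrix.mul_neg, ← Matrix.mul_assoc, hF', Matrix.mul_assoc]
    rw [hc, Matrix.smul_mul, Matrix.sub_mul, h1, h2, Matrix.mul_neg, Matrix.mul_smul,
      Matrix.mul_sub, ← smul_neg]
    congr 1
    abel
end
end

section
/- Suppose F ∈ ℂ^{n×n}, G ∈ ℂ^{n×m}, H ∈ ℂ^{m×n}, K ∈ ℂ^{m×m} form a minimal realization, i.e. rank[G, FG, …, F^{n−1}G] = n and rank[H; HF; …; HF^{n−1}] = n. Then (F, G, H, K) is physically realizable in the annihilation-operator sense if and only if the transfer function Γ(s) = H(sI − F)^{−1}G + K is lossless bounded real (i.e. F is Hurwitz and Γ(iω)†Γ(iω) = I_m for all ω ∈ ℝ). -/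
open Matrix
open scoped ComplexOrder

noncomputable section

/-- Physical realizability in the annihilation-operator sense: there exist a Hermitian
positive-definite `Θ₁`, a Hermitian `M₁`, a matrix `N₁`, and `S` with `S†S = I` such that
`F = −iΘ₁M₁ − (1/2)Θ₁N₁†N₁`, `G = −Θ₁N₁†S`, `H = N₁` and `K = S`. -/
def PhysRealAnn {N M : Type*} [Fintype N] [Fintype M] [DecidableEq N] [DecidableEq M]
    (F : Matrix N N ℂ) (G : Matrix N M ℂ) (H : Matrix M N ℂ) (K : Matrix M M ℂ) : Prop :=
  ∃ (Θ₁ M₁ : Matrix N N ℂ) (N₁ : Matrix M N ℂ) (S : Matrix M M ℂ),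
    Θ₁.PosDef ∧ M₁ᴴ = M₁ ∧ Sᴴ * S = 1 ∧
    F = -(Complex.I • (Θ₁ * M₁)) - (1 / 2 : ℂ) • (Θ₁ * N₁ᴴ * N₁) ∧
    G = -(Θ₁ * N₁ᴴ * S) ∧ H = N₁ ∧ K = S

/-- A square complex matrix is Hurwitz if every element of its spectrum has negative
real part. -/
def IsHurwitz {N : Type*} [Fintype N] [DecidableEq N] (F : Matrix N N ℂ) : Prop :=
  ∀ μ ∈ spectrum ℂ F, μ.re < 0

/-- The transfer function `Γ(s) = H (sI − F)⁻¹ G + K`. -/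
def transferFn {N M P : Type*} [Fintype N] [DecidableEq N]
    (F : Matrix N N ℂ) (G : Matrix N M ℂ) (H : Matrix P N ℂ) (K : Matrix P M ℂ)
    (s : ℂ) : Matrix P M ℂ :=
  H * (s • (1 : Matrix N N ℂ) - F)⁻¹ * G + K

/-- The transfer function is lossless bounded real if `F` is Hurwitz and
`Γ(iω)† Γ(iω) = I` for all real `ω`. -/
def LosslessBoundedReal {N M : Type*} [Fintype N] [Fintype M] [DecidableEq N] [DecidableEq M]
    (F : Matrix N N ℂ) (G : Matrix N M ℂ) (H : Matrix M N ℂ) (K : Matrix M M ℂ) : Prop :=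
  IsHurwitz F ∧
    ∀ ω : ℝ, (transferFn F G H K ((ω : ℂ) * Complex.I))ᴴ *
      transferFn F G H K ((ω : ℂ) * Complex.I) = 1

/-- The horizontally concatenated controllability matrix `[G, FG, …, F^{k−1}G]`. -/
def ctrbMat {N M : Type*} [Fintype N] [DecidableEq N]
    (F : Matrix N N ℂ) (G : Matrix N M ℂ) (k : ℕ) : Matrix N (Fin k × M) ℂ :=
  Matrix.of fun i p => (F ^ (p.1 : ℕ) * G) i p.2

/-- The vertically concatenated observability matrix `[H; HF; …; HF^{k−1}]`. -/
def obsvMat {N M : Type*} [Fintype N] [DecidableEq N]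
    (F : Matrix N N ℂ) (H : Matrix M N ℂ) (k : ℕ) : Matrix (Fin k × M) N ℂ :=
  Matrix.of fun p j => (H * F ^ (p.1 : ℕ)) p.2 j

open Filter Topology Polynomial Bornology

section Spectrum

variable {N : Type*} [Fintype N] [DecidableEq N]

/-- An element of the spectrum of a complex matrix has an eigenvector. -/
lemma exists_eigenvector_of_mem_spectrum {F : Matrix N N ℂ} {μ : ℂ} (h : μ ∈ spectrum ℂ F) :
    ∃ v, v ≠ 0 ∧ F *ᵥ v = μ • v := by
  rw [spectrum.mem_iff, Matrix.isUnit_iff_isUnit_det, isUnit_iff_ne_zero, not_not,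
    ← Matrix.exists_mulVec_eq_zero_iff] at h
  obtain ⟨v, hv, h⟩ := h
  refine ⟨v, hv, ?_⟩
  rw [Matrix.sub_mulVec, Algebra.algebraMap_eq_smul_one, Matrix.smul_mulVec, Matrix.one_mulVec,
    sub_eq_zero] at h
  exact h.symm

/-- An eigenvalue of a complex matrix lies in its spectrum. -/
lemma mem_spectrum_of_mulVec_eq {F : Matrix N N ℂ} {μ : ℂ} {v : N → ℂ} (hv : v ≠ 0)
    (h : F *ᵥ v = μ • v) : μ ∈ spectrum ℂ F := by
  rw [spectrum.mem_iff, Matrix.isUnit_iff_isUnit_det, isUnit_iff_ne_zero, not_not,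
    ← Matrix.exists_mulVec_eq_zero_iff]
  refine ⟨v, hv, ?_⟩
  rw [Matrix.sub_mulVec, Algebra.algebraMap_eq_smul_one, Matrix.smul_mulVec, Matrix.one_mulVec,
    h, sub_self]

/-- The powers of a complex matrix with spectrum inside the open unit disc tend to zero. -/
lemma tendsto_pow_of_spectrum_lt_one {A : Matrix N N ℂ} (hA : ∀ μ ∈ spectrum ℂ A, ‖μ‖ < 1) :
    Tendsto (fun k : ℕ => A ^ k) atTop (𝓝 0) := by
  let _ := Matrix.linftyOpNormedRing (n := N) (α := ℂ)
  let _ := Matrix.linftyOpNormedAlgebra (n := N) (R := ℂ) (α := ℂ)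
  cases isEmpty_or_nonempty N
  · exact tendsto_const_nhds.congr fun k => Subsingleton.elim _ _
  have hlt : spectralRadius ℂ A < (1 : NNReal) :=
    spectrum.spectralRadius_lt_of_forall_lt A fun μ hμ => by
      simpa [← NNReal.coe_lt_coe] using hA μ hμ
  obtain ⟨r, hr, hr1⟩ := ENNReal.lt_iff_exists_nnreal_btwn.1 hlt
  have hev := (spectrum.pow_nnnorm_pow_one_div_tendsto_nhds_spectralRadius A).eventually_lt_const hr
  refine squeeze_zero_norm' (a := fun k => (r : ℝ) ^ k) ?_
    (tendsto_pow_atTop_nhds_zero_of_lt_one r.2 (by exact_mod_cast hr1))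
  filter_upwards [hev, eventually_gt_atTop 0] with k hk hk0
  have hk0' : (0 : ℝ) < k := by exact_mod_cast hk0
  rw [one_div, ENNReal.rpow_inv_lt_iff hk0', ENNReal.rpow_natCast] at hk
  exact_mod_cast hk.le

end Spectrum

section Hurwitz

variable {N : Type*} [Fintype N] [DecidableEq N] {F : Matrix N N ℂ}

lemma IsHurwitz.notMem_spectrum (hF : IsHurwitz F) {s : ℂ} (hs : 0 ≤ s.re) :
    s ∉ spectrum ℂ F := fun h => (hF s h).not_ge hs

lemma IsHurwitz.isUnit_smul_one_sub (hF : IsHurwitz F) {s : ℂ} (hs : 0 ≤ s.re) :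
    IsUnit (s • (1 : Matrix N N ℂ) - F) := by
  have h := hF.notMem_spectrum hs
  rwa [spectrum.notMem_iff, Algebra.algebraMap_eq_smul_one] at h

lemma IsHurwitz.conjTranspose (hF : IsHurwitz F) : IsHurwitz Fᴴ := by
  intro μ hμ
  have h : star μ ∈ spectrum ℂ F := by
    rw [← star_eq_conjTranspose, spectrum.map_star] at hμ
    exact hμ
  simpa using hF _ h

/-- For Hurwitz `F` the spectra of `F` and `-F†` are disjoint, so `p(-F†)` is invertible where
`p` is the characteristic polynomial of `F`. -/
lemma IsHurwitz.isUnit_aeval_charpoly (hF : IsHurwitz F) :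
    IsUnit (aeval (-Fᴴ) F.charpoly) := by
  cases isEmpty_or_nonempty N
  · exact isUnit_of_subsingleton _
  rw [← spectrum.zero_notMem_iff ℂ, spectrum.map_polynomial_aeval_of_nonempty]
  · rintro ⟨μ, hμ, h0⟩
    have h1 : μ ∈ spectrum ℂ F := Matrix.mem_spectrum_iff_isRoot_charpoly.2 h0
    rw [← spectrum.neg_eq, Set.mem_neg] at hμ
    have h2 := hF.conjTranspose _ hμ
    have h3 := hF _ h1
    rw [Complex.neg_re] at h2
    linarith
  · exact spectrum.nonempty_of_isAlgClosed_of_finiteDimensional ℂ _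

/-- A matrix intertwining `F` and `-F†` vanishes when `F` is Hurwitz. -/
lemma IsHurwitz.eq_zero_of_lyapunov (hF : IsHurwitz F) {X : Matrix N N ℂ}
    (hX : X * F + Fᴴ * X = 0) : X = 0 := by
  have hs : X * F = (-Fᴴ) * X := by rw [neg_mul]; exact eq_neg_of_add_eq_zero_left hX
  have hp : ∀ p : ℂ[X], X * aeval F p = aeval (-Fᴴ) p * X := by
    intro p
    induction p using Polynomial.induction_on' with
    | add p q hp hq => simp only [map_add, mul_add, add_mul, hp, hq]
    | monomial k a =>
      have hk : X * F ^ k = (-Fᴴ) ^ k * X :=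
        SemiconjBy.pow_right (show SemiconjBy X F (-Fᴴ) from hs) k
      simp only [aeval_monomial, Algebra.algebraMap_eq_smul_one, smul_mul_assoc, one_mul,
        mul_smul_comm, hk]
  have h := hp F.charpoly
  rw [Matrix.aeval_self_charpoly, mul_zero] at h
  exact hF.isUnit_aeval_charpoly.mul_right_eq_zero.1 h.symm

/-- Existence of solutions of the Lyapunov equation. -/
lemma IsHurwitz.exists_lyapunov (hF : IsHurwitz F) (Q : Matrix N N ℂ) :
    ∃ X, X * F + Fᴴ * X = Q := by
  let L : Matrix N N ℂ →ₗ[ℂ] Matrix N N ℂ := LinearMap.mulRight ℂ F + LinearMap.mulLeft ℂ Fᴴ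
  have hinj : Function.Injective L := (injective_iff_map_eq_zero L).2 fun X hX =>
    hF.eq_zero_of_lyapunov hX
  exact LinearMap.injective_iff_surjective.1 hinj Q

/-- The Cayley transform of a Hurwitz matrix has spectrum inside the open unit disc. -/
lemma IsHurwitz.norm_lt_one_of_mem_spectrum_cayley (hF : IsHurwitz F) {μ : ℂ}
    (hμ : μ ∈ spectrum ℂ ((1 + F) * (1 - F)⁻¹)) : ‖μ‖ < 1 := by
  have hu : IsUnit (1 - F).det := by
    have := hF.isUnit_smul_one_sub (s := 1) (by simp)
    rwa [one_smul, Matrix.isUnit_iff_isUnit_det] at this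
  obtain ⟨v, hv, h⟩ := exists_eigenvector_of_mem_spectrum hμ
  set w := (1 - F)⁻¹ *ᵥ v with hw
  have hvw : v = (1 - F) *ᵥ w := by
    rw [hw, Matrix.mulVec_mulVec, Matrix.mul_nonsing_inv _ hu, Matrix.one_mulVec]
  have hw0 : w ≠ 0 := by
    intro h0
    rw [h0, Matrix.mulVec_zero] at hvw
    exact hv hvw
  rw [← Matrix.mulVec_mulVec, ← hw, hvw, Matrix.add_mulVec, Matrix.sub_mulVec,
    Matrix.one_mulVec] at h
  have h1 : (μ + 1) • (F *ᵥ w) = (μ - 1) • w := by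
    rw [← sub_eq_zero] at h ⊢
    rw [← h]
    module
  have hne : μ + 1 ≠ 0 := by
    intro h0
    rw [h0, zero_smul] at h1
    rcases smul_eq_zero.1 h1.symm with h2 | h2
    · have : (2 : ℂ) = 0 := by linear_combination h0 - h2
      norm_num at this
    · exact hw0 h2
  have h2 : F *ᵥ w = ((μ - 1) / (μ + 1)) • w := by
    rw [div_eq_inv_mul, mul_smul, ← h1, smul_smul, inv_mul_cancel₀ hne, one_smul]
  have h3 := hF _ (mem_spectrum_of_mulVec_eq hw0 h2)
  have hpos : 0 < Complex.normSq (μ + 1) := Complex.normSq_pos.2 hne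
  rw [Complex.div_re, ← add_div, div_lt_iff₀ hpos] at h3
  simp only [Complex.sub_re, Complex.add_re, Complex.one_re, Complex.sub_im, Complex.add_im,
    Complex.one_im] at h3
  have h4 : ‖μ‖ ^ 2 < 1 := by
    rw [Complex.sq_norm, Complex.normSq_apply]
    nlinarith
  nlinarith [norm_nonneg μ]

/-- A Hermitian solution of a Lyapunov inequality with Hurwitz `F` is positive semidefinite. -/
lemma IsHurwitz.posSemidef_of_lyapunov (hF : IsHurwitz F) {X Q : Matrix N N ℂ}
    (hXh : X.IsHermitian) (hQ : Q.PosSemidef) (hX : X * F + Fᴴ * X = -Q) : X.PosSemidef := by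
  have hu : IsUnit (1 - F).det := by
    have := hF.isUnit_smul_one_sub (s := 1) (by simp)
    rwa [one_smul, Matrix.isUnit_iff_isUnit_det] at this
  set B := (1 - F)⁻¹ with hB
  set A := (1 + F) * B with hA
  have hAB : (1 - F) * B = 1 := Matrix.mul_nonsing_inv _ hu
  have hstep : X - Aᴴ * X * A = Bᴴ * ((2 : ℂ) • Q) * B := by
    have h1 : X = Bᴴ * ((1 - F)ᴴ * X * (1 - F)) * B := by
      have h2 : Bᴴ * (1 - F)ᴴ = 1 := by
        rw [← Matrix.conjTranspose_mul, hAB, Matrix.conjTranspose_one]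
      calc X = (Bᴴ * (1 - F)ᴴ) * X * ((1 - F) * B) := by rw [h2, hAB, one_mul, mul_one]
        _ = _ := by simp only [mul_assoc]
    have h3 : Aᴴ * X * A = Bᴴ * ((1 + F)ᴴ * X * (1 + F)) * B := by
      rw [hA, Matrix.conjTranspose_mul]; simp only [mul_assoc]
    have hQ' : Q = -(X * F + Fᴴ * X) := by rw [hX, neg_neg]
    rw [h3]
    nth_rw 1 [h1]
    rw [← sub_mul, ← mul_sub, hQ']
    congr 2
    simp only [Matrix.conjTranspose_add, Matrix.conjTranspose_sub, Matrix.conjTranspose_one,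
      two_smul]
    noncomm_ring
  have hD : (X - Aᴴ * X * A).PosSemidef := by
    rw [hstep]
    exact (hQ.smul (by norm_num)).conjTranspose_mul_mul_same B
  have hk : ∀ k : ℕ, (X - (A ^ k)ᴴ * X * A ^ k).PosSemidef := by
    intro k
    induction k with
    | zero => simpa using Matrix.PosSemidef.zero
    | succ k ih =>
      have := ih.add (hD.conjTranspose_mul_mul_same (A ^ k))
      convert this using 1
      rw [pow_succ', Matrix.conjTranspose_mul]
      noncomm_ring
  have hlim : Tendsto (fun k : ℕ => X - (A ^ k)ᴴ * X * A ^ k) atTop (𝓝 X) := by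
    have h0 := tendsto_pow_of_spectrum_lt_one (A := A)
      fun μ hμ => hF.norm_lt_one_of_mem_spectrum_cayley hμ
    have hc : Continuous fun Z : Matrix N N ℂ => X - Zᴴ * X * Z := by fun_prop
    have h1 := (hc.tendsto 0).comp h0
    simp only [mul_zero, sub_zero] at h1
    exact h1
  refine Matrix.PosSemidef.of_dotProduct_mulVec_nonneg hXh fun x => ?_
  have hc : Continuous fun Z : Matrix N N ℂ => star x ⬝ᵥ (Z *ᵥ x) := by fun_prop
  exact ge_of_tendsto' ((hc.tendsto X).comp hlim) fun k => (hk k).dotProduct_mulVec_nonneg x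

end Hurwitz

section Realization

variable {N M : Type*} [Fintype N] [DecidableEq N]

/-- A full-rank observability matrix has trivial kernel. -/
lemma eq_zero_of_obsvMat_rank {F : Matrix N N ℂ} {H : Matrix M N ℂ} {k : ℕ}
    (h : (obsvMat F H k).rank = Fintype.card N) {v : N → ℂ}
    (hv : ∀ j : ℕ, (H * F ^ j) *ᵥ v = 0) : v = 0 := by
  have h1 := (obsvMat F H k).mulVecLin.finrank_range_add_finrank_ker
  rw [Module.finrank_fintype_fun_eq_card] at h1
  have h2 : Module.finrank ℂ (obsvMat F H k).mulVecLin.ker = 0 := by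
    change Module.finrank ℂ (obsvMat F H k).mulVecLin.range = _ at h
    omega
  have h3 := Submodule.finrank_eq_zero.1 h2
  refine Matrix.ker_mulVecLin_eq_bot_iff.1 h3 v ?_
  ext p
  exact congrFun (hv p.1) p.2

lemma obsvMat_conjTranspose (F : Matrix N N ℂ) (G : Matrix N M ℂ) (k : ℕ) :
    obsvMat Fᴴ Gᴴ k = (ctrbMat F G k)ᴴ := by
  ext p j
  simp only [obsvMat, ctrbMat, Matrix.of_apply, Matrix.conjTranspose_apply]
  rw [← Matrix.conjTranspose_pow, ← Matrix.conjTranspose_mul, Matrix.conjTranspose_apply]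

/-- The resolvent tends to zero along the imaginary axis. -/
lemma tendsto_resolvent_imaginary (F : Matrix N N ℂ) :
    Tendsto (fun ω : ℝ => (((ω : ℂ) * Complex.I) • (1 : Matrix N N ℂ) - F)⁻¹) atTop (𝓝 0) := by
  let _ := Matrix.linftyOpNormedRing (n := N) (α := ℂ)
  let _ := Matrix.linftyOpNormedAlgebra (n := N) (R := ℂ) (α := ℂ)
  have h := spectrum.resolvent_tendsto_cobounded (𝕜 := ℂ) F
  have h2 : Tendsto (fun ω : ℝ => (ω : ℂ) * Complex.I) atTop (cobounded ℂ) := by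
    rw [← tendsto_norm_atTop_iff_cobounded]
    simpa using tendsto_abs_atTop_atTop
  refine (h.comp h2).congr fun ω => ?_
  simp [resolvent, Algebra.algebraMap_eq_smul_one, Matrix.nonsing_inv_eq_ringInverse]

variable [Fintype M]

/-- Physical realizability in terms of a positive definite solution of Lyapunov-type equations. -/
lemma physRealAnn_iff [DecidableEq M] {F : Matrix N N ℂ} {G : Matrix N M ℂ} {H : Matrix M N ℂ}
    {K : Matrix M M ℂ} : PhysRealAnn F G H K ↔
      ∃ X : Matrix N N ℂ, X.PosDef ∧ X * F + Fᴴ * X = -(Hᴴ * H) ∧ X * G = -(Hᴴ * K) ∧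
        Kᴴ * K = 1 := by
  constructor
  · rintro ⟨Θ, W, L, S, hΘ, hW, hS, hF, hG, rfl, rfl⟩
    have hu : IsUnit Θ.det := (Matrix.isUnit_iff_isUnit_det _).1 hΘ.isUnit
    have hXF : Θ⁻¹ * F = -(Complex.I • W) - (1 / 2 : ℂ) • (Hᴴ * H) := by
      rw [hF]
      simp only [mul_sub, mul_neg, Matrix.mul_smul, Matrix.mul_assoc,
        Matrix.nonsing_inv_mul_cancel_left _ _ hu]
    have hFX : Fᴴ * Θ⁻¹ = Complex.I • W - (1 / 2 : ℂ) • (Hᴴ * H) := by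
      have := congrArg Matrix.conjTranspose hXF
      rw [Matrix.conjTranspose_mul, hΘ.inv.isHermitian.eq] at this
      rw [this]
      simp [Matrix.conjTranspose_smul, hW]
    refine ⟨Θ⁻¹, hΘ.inv, ?_, ?_, hS⟩
    · rw [hXF, hFX]
      module
    · rw [hG, Matrix.mul_neg, Matrix.mul_assoc, Matrix.nonsing_inv_mul_cancel_left _ _ hu]
  · rintro ⟨X, hX, hL, hG, hK⟩
    have hu : IsUnit X.det := (Matrix.isUnit_iff_isUnit_det _).1 hX.isUnit
    refine ⟨X⁻¹, Complex.I • (X * F + (1 / 2 : ℂ) • (Hᴴ * H)), H, K, hX.inv, ?_, hK, ?_, ?_,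
      rfl, rfl⟩
    · have hFX : Fᴴ * X = -(Hᴴ * H) - X * F := by rw [← hL]; abel
      simp only [Matrix.conjTranspose_smul, Matrix.conjTranspose_add, Matrix.conjTranspose_mul,
        Matrix.conjTranspose_conjTranspose, hX.isHermitian.eq, hFX]
      simp
      module
    · simp only [Matrix.mul_smul, mul_add, Matrix.nonsing_inv_mul_cancel_left _ _ hu, smul_smul,
        smul_add, Matrix.mul_assoc]
      simp only [← mul_assoc, Complex.I_mul_I]
      module
    · rw [Matrix.mul_assoc, ← Matrix.mul_neg, ← hG, Matrix.nonsing_inv_mul_cancel_left _ _ hu]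

/-- The key identity for `Γ(iω)†Γ(iω)` in terms of a solution of the Lyapunov equation. -/
lemma transferFn_conjTranspose_mul_self {F X : Matrix N N ℂ} {G : Matrix N M ℂ}
    {H : Matrix M N ℂ} {K : Matrix M M ℂ} (hF : IsHurwitz F) (hXh : Xᴴ = X)
    (hX : X * F + Fᴴ * X = -(Hᴴ * H)) (ω : ℝ) :
    (transferFn F G H K ((ω : ℂ) * Complex.I))ᴴ * transferFn F G H K ((ω : ℂ) * Complex.I) =
      ((X * G + Hᴴ * K)ᴴ * (((ω : ℂ) * Complex.I) • (1 : Matrix N N ℂ) - F)⁻¹ * G)ᴴ +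
        (X * G + Hᴴ * K)ᴴ * (((ω : ℂ) * Complex.I) • (1 : Matrix N N ℂ) - F)⁻¹ * G +
          Kᴴ * K := by
  have hu := hF.isUnit_smul_one_sub (s := (ω : ℂ) * Complex.I) (by simp)
  rw [Matrix.isUnit_iff_isUnit_det] at hu
  unfold transferFn
  set T := ((ω : ℂ) * Complex.I) • (1 : Matrix N N ℂ) - F with hT
  have hHH : Hᴴ * H = X * T + Tᴴ * X := by
    have h1 : Tᴴ = -(((ω : ℂ) * Complex.I) • (1 : Matrix N N ℂ)) - Fᴴ := by
      simp [hT, Matrix.conjTranspose_smul]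
    rw [← neg_neg (Hᴴ * H), ← hX, h1, hT]
    simp only [mul_sub, sub_mul, neg_mul, smul_mul_assoc, mul_smul_comm, mul_one, one_mul]
    abel
  set R := T⁻¹ with hR
  have hTR : T * R = 1 := Matrix.mul_nonsing_inv _ hu
  have hRT : Rᴴ * Tᴴ = 1 := by rw [← Matrix.conjTranspose_mul, hTR, Matrix.conjTranspose_one]
  have hkey : Rᴴ * (Hᴴ * H) * R = Rᴴ * X + X * R := by
    calc Rᴴ * (Hᴴ * H) * R = Rᴴ * X * (T * R) + (Rᴴ * Tᴴ) * X * R := by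
          rw [hHH]; simp only [mul_add, add_mul, mul_assoc]
      _ = _ := by rw [hTR, hRT, mul_one, one_mul]
  have hkey' : Gᴴ * (Rᴴ * (Hᴴ * (H * (R * G)))) = Gᴴ * (Rᴴ * (X * G)) + Gᴴ * (X * (R * G)) := by
    have := congrArg (fun Z => Gᴴ * Z * G) hkey
    simpa only [Matrix.mul_add, Matrix.add_mul, Matrix.mul_assoc] using this
  simp only [Matrix.conjTranspose_add, Matrix.conjTranspose_mul,
    Matrix.conjTranspose_conjTranspose, hXh, Matrix.mul_add, Matrix.add_mul, Matrix.mul_assoc,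
    hkey']
  abel

/-- If two strictly proper transfer functions agree on the imaginary axis, then so do their leading
Markov parameters and the transfer functions of the shifted realizations. -/
lemma shift_eq_of_transfer_eq {P Q : Type*} [Fintype P] [Fintype Q] {A A' : Matrix N N ℂ}
    {B B' : Matrix N Q ℂ} {C C' : Matrix P N ℂ}
    (hA : ∀ ω : ℝ, IsUnit (((ω : ℂ) * Complex.I) • (1 : Matrix N N ℂ) - A))
    (hA' : ∀ ω : ℝ, IsUnit (((ω : ℂ) * Complex.I) • (1 : Matrix N N ℂ) - A'))
    (h : ∀ ω : ℝ, C * (((ω : ℂ) * Complex.I) • (1 : Matrix N N ℂ) - A)⁻¹ * B =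
      C' * (((ω : ℂ) * Complex.I) • (1 : Matrix N N ℂ) - A')⁻¹ * B') :
    C * B = C' * B' ∧ ∀ ω : ℝ,
      C * A * (((ω : ℂ) * Complex.I) • (1 : Matrix N N ℂ) - A)⁻¹ * B =
        C' * A' * (((ω : ℂ) * Complex.I) • (1 : Matrix N N ℂ) - A')⁻¹ * B' := by
  have hlim : ∀ (D : Matrix P N ℂ) (E : Matrix N N ℂ) (V : Matrix N Q ℂ), Tendsto (fun ω : ℝ =>
        D * V + D * E * (((ω : ℂ) * Complex.I) • (1 : Matrix N N ℂ) - E)⁻¹ * V) atTop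
        (𝓝 (D * V)) := by
    intro D E V
    have hc : Continuous fun Z : Matrix N N ℂ => D * V + D * E * Z * V := by fun_prop
    have := (hc.tendsto 0).comp (tendsto_resolvent_imaginary E)
    simp only [Matrix.mul_zero, Matrix.zero_mul, add_zero] at this
    exact this
  have hres : ∀ (D : Matrix P N ℂ) (E : Matrix N N ℂ) (V : Matrix N Q ℂ) (s : ℂ),
      IsUnit (s • (1 : Matrix N N ℂ) - E) →
      s • (D * (s • (1 : Matrix N N ℂ) - E)⁻¹ * V) =
        D * V + D * E * (s • (1 : Matrix N N ℂ) - E)⁻¹ * V := by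
    intro D E V s hs
    have h1 := Matrix.mul_nonsing_inv _ ((Matrix.isUnit_iff_isUnit_det _).1 hs)
    set R := (s • (1 : Matrix N N ℂ) - E)⁻¹
    rw [sub_mul, smul_mul_assoc, one_mul, sub_eq_iff_eq_add] at h1
    calc s • (D * R * V) = D * (s • R) * V := by simp
      _ = _ := by rw [h1]; simp only [Matrix.mul_add, Matrix.add_mul, Matrix.mul_one,
                    Matrix.mul_assoc]
  have heq : ∀ ω : ℝ,
      C * B + C * A * (((ω : ℂ) * Complex.I) • (1 : Matrix N N ℂ) - A)⁻¹ * B =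
        C' * B' + C' * A' * (((ω : ℂ) * Complex.I) • (1 : Matrix N N ℂ) - A')⁻¹ * B' := by
    intro ω
    rw [← hres _ _ _ _ (hA ω), ← hres _ _ _ _ (hA' ω), h ω]
  have h0 : C * B = C' * B' :=
    tendsto_nhds_unique ((hlim C A B).congr heq) (hlim C' A' B')
  exact ⟨h0, fun ω => add_left_cancel ((heq ω).trans (by rw [h0]))⟩

/-- Markov parameters are determined by the transfer function on the imaginary axis. -/
lemma markov_eq_of_transfer_eq {P Q : Type*} [Fintype P] [Fintype Q] {A A' : Matrix N N ℂ}
    {B B' : Matrix N Q ℂ} {C C' : Matrix P N ℂ}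
    (hA : ∀ ω : ℝ, IsUnit (((ω : ℂ) * Complex.I) • (1 : Matrix N N ℂ) - A))
    (hA' : ∀ ω : ℝ, IsUnit (((ω : ℂ) * Complex.I) • (1 : Matrix N N ℂ) - A'))
    (h : ∀ ω : ℝ, C * (((ω : ℂ) * Complex.I) • (1 : Matrix N N ℂ) - A)⁻¹ * B =
      C' * (((ω : ℂ) * Complex.I) • (1 : Matrix N N ℂ) - A')⁻¹ * B') (k : ℕ) :
    C * A ^ k * B = C' * A' ^ k * B' := by
  induction k generalizing C C' with
  | zero => simpa using (shift_eq_of_transfer_eq hA hA' h).1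
  | succ k ih =>
    have := ih (shift_eq_of_transfer_eq hA hA' h).2
    rwa [Matrix.mul_assoc C, Matrix.mul_assoc C', ← pow_succ', ← pow_succ'] at this

/-- If `Y†(s - F)⁻¹G` and `G†(s + F†)⁻¹Y` have the same Markov parameters, `F` is Hurwitz and
`(F, G)` is controllable, then `Y = 0`. -/
lemma IsHurwitz.eq_zero_of_markov_eq {F : Matrix N N ℂ} {G Y : Matrix N M ℂ} {l : ℕ}
    (hF : IsHurwitz F) (hG : (ctrbMat F G l).rank = Fintype.card N)
    (h : ∀ k : ℕ, Yᴴ * F ^ k * G = Gᴴ * (-Fᴴ) ^ k * Y) : Y = 0 := by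
  have hp : ∀ p : ℂ[X], Yᴴ * aeval F p * G = Gᴴ * aeval (-Fᴴ) p * Y := by
    intro p
    induction p using Polynomial.induction_on' with
    | add p q hp hq => simp only [map_add, Matrix.mul_add, Matrix.add_mul, hp, hq]
    | monomial k a =>
      simp only [aeval_monomial, Algebra.algebraMap_eq_smul_one, smul_mul_assoc, one_mul,
        Matrix.mul_smul, Matrix.smul_mul, h]
  have hZ : aeval (-Fᴴ) F.charpoly * Y = 0 := by
    have hobs : (obsvMat Fᴴ Gᴴ l).rank = Fintype.card N := by
      rw [obsvMat_conjTranspose, Matrix.rank_conjTranspose, hG]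
    ext i j
    refine congrFun (eq_zero_of_obsvMat_rank hobs
      (v := fun i => (aeval (-Fᴴ) F.charpoly * Y) i j) fun k => ?_) i
    have h1 := hp (X ^ k * F.charpoly)
    simp only [map_mul, Matrix.aeval_self_charpoly, mul_zero, Matrix.mul_zero, Matrix.zero_mul,
      map_pow, aeval_X, neg_pow Fᴴ] at h1
    have h2 : Gᴴ * Fᴴ ^ k * (aeval (-Fᴴ) F.charpoly * Y) = 0 := by
      rcases neg_one_pow_eq_or (Matrix N N ℂ) k with hk | hk <;> rw [hk] at h1
      · simpa [Matrix.mul_assoc] using h1.symm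
      · simpa [Matrix.mul_assoc] using h1.symm
    ext i
    exact congrFun (congrFun h2 i) j
  have hu := (Matrix.isUnit_iff_isUnit_det _).1 hF.isUnit_aeval_charpoly
  rw [← Matrix.nonsing_inv_mul_cancel_left _ Y hu, hZ, Matrix.mul_zero]

/-- A positive definite solution of the Lyapunov equation of an observable pair forces stability. -/
lemma isHurwitz_of_lyapunov {F X : Matrix N N ℂ} {H : Matrix M N ℂ} {l : ℕ}
    (hobs : (obsvMat F H l).rank = Fintype.card N) (hX : X.PosDef)
    (hL : X * F + Fᴴ * X = -(Hᴴ * H)) : IsHurwitz F := by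
  intro μ hμ
  by_contra! hre
  obtain ⟨v, hv, hFv⟩ := exists_eigenvector_of_mem_spectrum hμ
  have hq := hX.dotProduct_mulVec_pos hv
  have h1 := congrArg (fun Z => star v ⬝ᵥ (Z *ᵥ v)) hL
  have h2 : star v ⬝ᵥ ((X * F) *ᵥ v) = μ * (star v ⬝ᵥ (X *ᵥ v)) := by
    rw [← Matrix.mulVec_mulVec, hFv, Matrix.mulVec_smul, dotProduct_smul, smul_eq_mul]
  have h3 : star v ⬝ᵥ ((Fᴴ * X) *ᵥ v) = star μ * (star v ⬝ᵥ (X *ᵥ v)) := by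
    rw [← Matrix.mulVec_mulVec, Matrix.dotProduct_mulVec, ← Matrix.star_mulVec, hFv, star_smul,
      smul_dotProduct, smul_eq_mul]
  have h4 : star v ⬝ᵥ ((Hᴴ * H) *ᵥ v) = star (H *ᵥ v) ⬝ᵥ (H *ᵥ v) := by
    rw [← Matrix.mulVec_mulVec, Matrix.dotProduct_mulVec, ← Matrix.star_mulVec]
  simp only [Matrix.add_mulVec, Matrix.neg_mulVec, dotProduct_add, dotProduct_neg, h2, h3,
    h4] at h1
  have h5 : 0 ≤ (μ + star μ) * (star v ⬝ᵥ (X *ᵥ v)) := by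
    refine mul_nonneg ?_ hq.le
    rw [Complex.star_def, Complex.add_conj]
    exact_mod_cast (by positivity : 0 ≤ 2 * μ.re)
  have h6 : star (H *ᵥ v) ⬝ᵥ (H *ᵥ v) = 0 := by
    refine le_antisymm ?_ (dotProduct_star_self_nonneg _)
    rw [add_mul, h1] at h5
    exact neg_nonneg.1 h5
  have h7 : H *ᵥ v = 0 := dotProduct_star_self_eq_zero.1 h6
  refine hv (eq_zero_of_obsvMat_rank hobs fun j => ?_)
  have h8 : F ^ j *ᵥ v = μ ^ j • v := by
    induction j with
    | zero => simp
    | succ j ih => rw [pow_succ', ← Matrix.mulVec_mulVec, ih, Matrix.mulVec_smul, hFv, smul_smul,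
        pow_succ]
  rw [← Matrix.mulVec_mulVec, h8, Matrix.mulVec_smul, h7, smul_zero]

/-- For Hurwitz `F` and observable `(F, H)` the Lyapunov equation has a positive definite
solution. -/
lemma IsHurwitz.exists_posDef_lyapunov {F : Matrix N N ℂ} {H : Matrix M N ℂ} {l : ℕ}
    (hF : IsHurwitz F) (hobs : (obsvMat F H l).rank = Fintype.card N) :
    ∃ X : Matrix N N ℂ, X.PosDef ∧ X * F + Fᴴ * X = -(Hᴴ * H) := by
  obtain ⟨X, hX⟩ := hF.exists_lyapunov (-(Hᴴ * H))
  have hXh : Xᴴ = X := by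
    refine sub_eq_zero.1 (hF.eq_zero_of_lyapunov ?_)
    have h1 := congrArg Matrix.conjTranspose hX
    simp only [Matrix.conjTranspose_add, Matrix.conjTranspose_mul, Matrix.conjTranspose_neg,
      Matrix.conjTranspose_conjTranspose] at h1
    calc (Xᴴ - X) * F + Fᴴ * (Xᴴ - X) = (Fᴴ * Xᴴ + Xᴴ * F) - (X * F + Fᴴ * X) := by noncomm_ring
      _ = 0 := by rw [h1, hX, sub_self]
  have hpsd := hF.posSemidef_of_lyapunov hXh (Matrix.posSemidef_conjTranspose_mul_self H) hX
  have hker : ∀ v, X *ᵥ v = 0 → H *ᵥ v = 0 ∧ X *ᵥ (F *ᵥ v) = 0 := by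
    intro v hv
    have h1 := congrArg (fun Z => star v ⬝ᵥ (Z *ᵥ v)) hX
    have h2 : star v ᵥ* X = 0 := by
      rw [← hXh, ← Matrix.star_mulVec, hv, star_zero]
    simp only [Matrix.add_mulVec, Matrix.neg_mulVec, ← Matrix.mulVec_mulVec, hv,
      Matrix.mulVec_zero, add_zero] at h1
    rw [Matrix.dotProduct_mulVec, h2, zero_dotProduct, dotProduct_neg, Matrix.dotProduct_mulVec,
      ← Matrix.star_mulVec, eq_comm, neg_eq_zero] at h1
    have h3 : H *ᵥ v = 0 := dotProduct_star_self_eq_zero.1 h1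
    refine ⟨h3, ?_⟩
    have h4 := congrArg (fun Z => Z *ᵥ v) hX
    simpa [Matrix.add_mulVec, Matrix.neg_mulVec, ← Matrix.mulVec_mulVec, hv, h3] using h4
  refine ⟨X, hpsd.posDef_iff_isUnit.2 ?_, hX⟩
  rw [← Matrix.mulVec_injective_iff_isUnit]
  refine (injective_iff_map_eq_zero X.mulVecLin).2 fun v hv => ?_
  have hpow : ∀ j : ℕ, X *ᵥ (F ^ j *ᵥ v) = 0 := by
    intro j
    induction j with
    | zero => simpa using hv
    | succ j ih =>
      rw [pow_succ', ← Matrix.mulVec_mulVec]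
      exact (hker _ ih).2
  refine eq_zero_of_obsvMat_rank hobs fun j => ?_
  rw [← Matrix.mulVec_mulVec]
  exact (hker _ (hpow j)).1

/-- If `Y†RG` and its conjugate transpose add up to a constant along the imaginary axis, where
`R` is the resolvent of the Hurwitz matrix `F` and `(F, G)` is controllable, then `Y = 0` and the
constant vanishes. -/
lemma IsHurwitz.eq_zero_of_forall_add_eq {F : Matrix N N ℂ} {G Y : Matrix N M ℂ} {l : ℕ}
    {E : Matrix M M ℂ} (hF : IsHurwitz F) (hG : (ctrbMat F G l).rank = Fintype.card N)
    (h : ∀ ω : ℝ, (Yᴴ * (((ω : ℂ) * Complex.I) • (1 : Matrix N N ℂ) - F)⁻¹ * G)ᴴ +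
      Yᴴ * (((ω : ℂ) * Complex.I) • (1 : Matrix N N ℂ) - F)⁻¹ * G = E) : Y = 0 ∧ E = 0 := by
  have hE : E = 0 := by
    have hc : Continuous fun Z : Matrix N N ℂ => (Yᴴ * Z * G)ᴴ + Yᴴ * Z * G := by fun_prop
    have h1 := (hc.tendsto 0).comp (tendsto_resolvent_imaginary F)
    simp only [Matrix.mul_zero, Matrix.zero_mul, Matrix.conjTranspose_zero, add_zero] at h1
    exact tendsto_nhds_unique (tendsto_const_nhds.congr fun ω => (h ω).symm) h1
  have hR : ∀ ω : ℝ, ((ω : ℂ) * Complex.I) • (1 : Matrix N N ℂ) - -Fᴴ =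
      -(((ω : ℂ) * Complex.I) • (1 : Matrix N N ℂ) - F)ᴴ := by
    intro ω
    simp [Matrix.conjTranspose_smul]
    abel
  have hu : ∀ ω : ℝ, IsUnit (((ω : ℂ) * Complex.I) • (1 : Matrix N N ℂ) - F) := fun ω =>
    hF.isUnit_smul_one_sub (by simp)
  refine ⟨hF.eq_zero_of_markov_eq hG (markov_eq_of_transfer_eq hu (fun ω => ?_) fun ω => ?_), hE⟩
  · rw [hR]
    exact (hu ω).star.neg
  · have hinv : ∀ Z : Matrix N N ℂ, IsUnit Z → (-Z)⁻¹ = -Z⁻¹ := fun Z hZ =>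
      Matrix.inv_eq_right_inv (by
        rw [neg_mul_neg, Matrix.mul_nonsing_inv _ ((Matrix.isUnit_iff_isUnit_det _).1 hZ)])
    rw [hR, hinv (_)ᴴ (hu ω).star, ← Matrix.conjTranspose_nonsing_inv, eq_comm]
    have h1 := h ω
    rw [hE, add_comm] at h1
    rw [eq_neg_of_add_eq_zero_left h1]
    simp [Matrix.conjTranspose_mul, Matrix.mul_assoc]

end Realization

/-- for a minimal realization `(F,G,H,K)`, physical realizability in the
annihilation-operator sense is equivalent to the transfer function being lossless bounded
real. -/
theorem stmt9 (n m : ℕ) (hn : 0 < n) (hm : 0 < m)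
    (F : Matrix (Fin n) (Fin n) ℂ) (G : Matrix (Fin n) (Fin m) ℂ)
    (H : Matrix (Fin m) (Fin n) ℂ) (K : Matrix (Fin m) (Fin m) ℂ)
    (hctrb : (ctrbMat F G n).rank = n)
    (hobsv : (obsvMat F H n).rank = n) :
    PhysRealAnn F G H K ↔ LosslessBoundedReal F G H K := by
  have hc : (ctrbMat F G n).rank = Fintype.card (Fin n) := by simpa using hctrb
  have ho : (obsvMat F H n).rank = Fintype.card (Fin n) := by simpa using hobsv
  rw [physRealAnn_iff]
  constructor
  · rintro ⟨X, hX, hL, hG, hK⟩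
    have hF := isHurwitz_of_lyapunov ho hX hL
    refine ⟨hF, fun ω => ?_⟩
    rw [transferFn_conjTranspose_mul_self hF hX.isHermitian hL, hG, neg_add_cancel, hK]
    simp
  · rintro ⟨hF, hΓ⟩
    obtain ⟨X, hX, hL⟩ := hF.exists_posDef_lyapunov ho
    obtain ⟨hY, hE⟩ := hF.eq_zero_of_forall_add_eq (Y := X * G + Hᴴ * K) (E := 1 - Kᴴ * K) hc
      fun ω => by
        rw [← hΓ ω, transferFn_conjTranspose_mul_self hF hX.isHermitian hL, add_sub_cancel_right]
    exact ⟨X, hX, hL, eq_neg_of_add_eq_zero_left hY, (sub_eq_zero.1 hE).symm⟩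
end
end

section
/- If real matrices A ∈ ℝ^{2n×2n}, B ∈ ℝ^{2n×2m}, C ∈ ℝ^{2m×2n}, D ∈ ℝ^{2m×2m} are physically realizable in the real quadrature sense, then the transfer function Υ(s) := C(sI − A)^{−1}B + D satisfies Υ(s) J̃_m Υ(−s̄)† = J̃_m for every s ∈ ℂ with Re(s) ≥ 0 such that both sI − A and −s̄I − A are invertible (here matrices are regarded as complex matrices and † denotes conjugate transpose). -/
open Matrix

noncomputable section

/-- `J̃_k = [[0, I],[−I, 0]]` as a real `2k × 2k` block matrix. -/
def Jt (k : ℕ) : Matrix (Fin k ⊕ Fin k) (Fin k ⊕ Fin k) ℝ :=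
  Matrix.fromBlocks 0 1 (-1) 0

/-- Physical realizability in the real quadrature sense: there exist an invertible real
`S₀` with `Θ̃ := S₀ J̃_n S₀ᵀ`, a real symmetric `R` and a real `W` such that
`A = 2Θ̃R + (1/2)Θ̃Wᵀ J̃_m W`, `B = Θ̃Wᵀ J̃_m D`, `C = W`, `DDᵀ = I` and `D J̃_m Dᵀ = J̃_m`. -/
def PhysRealQuad {n m : ℕ}
    (A : Matrix (Fin n ⊕ Fin n) (Fin n ⊕ Fin n) ℝ)
    (B : Matrix (Fin n ⊕ Fin n) (Fin m ⊕ Fin m) ℝ)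
    (C : Matrix (Fin m ⊕ Fin m) (Fin n ⊕ Fin n) ℝ)
    (D : Matrix (Fin m ⊕ Fin m) (Fin m ⊕ Fin m) ℝ) : Prop :=
  ∃ (S₀ R : Matrix (Fin n ⊕ Fin n) (Fin n ⊕ Fin n) ℝ)
    (W : Matrix (Fin m ⊕ Fin m) (Fin n ⊕ Fin n) ℝ),
      IsUnit S₀ ∧ Rᵀ = R ∧
      A = (2 : ℝ) • ((S₀ * Jt n * S₀ᵀ) * R) +
            (1 / 2 : ℝ) • ((S₀ * Jt n * S₀ᵀ) * Wᵀ * Jt m * W) ∧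
      B = (S₀ * Jt n * S₀ᵀ) * Wᵀ * Jt m * D ∧
      C = W ∧
      D * Dᵀ = 1 ∧
      D * Jt m * Dᵀ = Jt m

/-- A real matrix regarded as a complex matrix. -/
def toC {α β : Type*} (R : Matrix α β ℝ) : Matrix α β ℂ :=
  R.map (fun x => (x : ℂ))

theorem Jt_transpose (k : ℕ) : (Jt k)ᵀ = -Jt k := by
  simp [Jt, fromBlocks_transpose, fromBlocks_neg]

theorem Jt_mul_self (k : ℕ) : Jt k * Jt k = -1 := by
  simp [Jt, fromBlocks_multiply, ← fromBlocks_one, fromBlocks_neg]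

section toC

variable {α β γ : Type*}

theorem toC_mul [Fintype β] (M : Matrix α β ℝ) (N : Matrix β γ ℝ) :
    toC (M * N) = toC M * toC N :=
  Matrix.map_mul (f := Complex.ofRealHom)

theorem toC_add (M N : Matrix α β ℝ) : toC (M + N) = toC M + toC N := by
  ext; simp [toC]

theorem toC_neg (M : Matrix α β ℝ) : toC (-M) = -toC M := by
  ext; simp [toC]

theorem toC_conjTranspose (M : Matrix α β ℝ) : (toC M)ᴴ = toC Mᵀ := by
  ext; simp [toC]

end toC

/-- A realizable system satisfies a Lyapunov equation and two coupling conditions with respect to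
a common matrix `Θ`. -/
theorem PhysRealQuad.exists_lyapunov {n m : ℕ}
    {A : Matrix (Fin n ⊕ Fin n) (Fin n ⊕ Fin n) ℝ}
    {B : Matrix (Fin n ⊕ Fin n) (Fin m ⊕ Fin m) ℝ}
    {C : Matrix (Fin m ⊕ Fin m) (Fin n ⊕ Fin n) ℝ}
    {D : Matrix (Fin m ⊕ Fin m) (Fin m ⊕ Fin m) ℝ}
    (h : PhysRealQuad A B C D) :
    ∃ Θ : Matrix (Fin n ⊕ Fin n) (Fin n ⊕ Fin n) ℝ,
      B * Jt m * Bᵀ = -(A * Θ + Θ * Aᵀ) ∧ B * Jt m * Dᵀ = -(Θ * Cᵀ) ∧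
      D * Jt m * Bᵀ = -(C * Θ) ∧ D * Jt m * Dᵀ = Jt m := by
  obtain ⟨S, R, W, -, hR, hA, hB, rfl, -, hD⟩ := h
  have hΘ : (S * Jt n * Sᵀ)ᵀ = -(S * Jt n * Sᵀ) := by
    simp [transpose_mul, Jt_transpose, Matrix.mul_assoc]
  generalize S * Jt n * Sᵀ = Θ at hA hB hΘ
  have hAt : Aᵀ = -((2 : ℝ) • (R * Θ)) + (1 / 2 : ℝ) • (Cᵀ * Jt m * C * Θ) := by
    simp [hA, transpose_mul, hΘ, hR, Jt_transpose, Matrix.mul_assoc]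
  have hBt : Bᵀ = Dᵀ * (Jt m * C * Θ) := by
    simp [hB, transpose_mul, hΘ, Jt_transpose, Matrix.mul_assoc]
  have hBJD : B * Jt m * Dᵀ = -(Θ * Cᵀ) := by
    calc B * Jt m * Dᵀ = Θ * Cᵀ * (Jt m * (D * Jt m * Dᵀ)) := by
          simp only [hB, Matrix.mul_assoc]
      _ = -(Θ * Cᵀ) := by simp [hD, Jt_mul_self]
  refine ⟨Θ, ?_, hBJD, ?_, hD⟩
  · rw [hBt, ← Matrix.mul_assoc, hBJD, hAt, hA]
    simp only [Matrix.add_mul, Matrix.mul_add, Matrix.smul_mul, Matrix.mul_smul, Matrix.mul_neg,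
      Matrix.neg_mul, Matrix.mul_assoc]
    module
  · rw [hBt, ← Matrix.mul_assoc, hD, Matrix.mul_assoc, ← Matrix.mul_assoc, Jt_mul_self]
    simp

/-- If `X Θ + Θ Z = B J B'`, `B J D' = -Θ C'`, `D J B' = -C Θ` and `D J D' = J`, then
`(C X⁻¹ B + D) J (B' Z⁻¹ C' + D') = J`. -/
theorem transfer_mul_transfer {ι κ K : Type*} [Fintype ι] [DecidableEq ι] [Fintype κ]
    [DecidableEq κ] [CommRing K] {X Z Θ : Matrix ι ι K} {B C' : Matrix ι κ K}
    {C B' : Matrix κ ι K} {D D' J : Matrix κ κ K} (hX : IsUnit X) (hZ : IsUnit Z)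
    (hBB : B * J * B' = X * Θ + Θ * Z) (hBD : B * J * D' = -(Θ * C'))
    (hDB : D * J * B' = -(C * Θ)) (hDD : D * J * D' = J) :
    (C * X⁻¹ * B + D) * J * (B' * Z⁻¹ * C' + D') = J := by
  rw [Matrix.isUnit_iff_isUnit_det] at hX hZ
  have hmid : X⁻¹ * (B * J * B') * Z⁻¹ = Θ * Z⁻¹ + X⁻¹ * Θ := by
    rw [hBB, Matrix.mul_add, Matrix.add_mul, nonsing_inv_mul_cancel_left _ _ hX,
      ← Matrix.mul_assoc X⁻¹, mul_nonsing_inv_cancel_right _ _ hZ]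
  calc (C * X⁻¹ * B + D) * J * (B' * Z⁻¹ * C' + D')
      = C * (X⁻¹ * (B * J * B') * Z⁻¹) * C' + C * X⁻¹ * (B * J * D') +
          (D * J * B') * Z⁻¹ * C' + D * J * D' := by
        simp only [Matrix.add_mul, Matrix.mul_add, Matrix.mul_assoc]
        abel
    _ = J := by
        rw [hmid, hBD, hDB, hDD]
        simp only [Matrix.add_mul, Matrix.mul_add, Matrix.mul_assoc, Matrix.mul_neg,
          Matrix.neg_mul]
        abel

/-- if `(A,B,C,D)` is physically realizable in the real quadrature sense, then
the transfer function `Υ(s) = C(sI − A)⁻¹B + D` satisfies `Υ(s) J̃_m Υ(−s̄)† = J̃_m` for every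
`s` with `Re s ≥ 0` such that `sI − A` and `−s̄I − A` are invertible. -/
theorem stmt15 (n m : ℕ) (hn : 0 < n) (hm : 0 < m)
    (A : Matrix (Fin n ⊕ Fin n) (Fin n ⊕ Fin n) ℝ)
    (B : Matrix (Fin n ⊕ Fin n) (Fin m ⊕ Fin m) ℝ)
    (C : Matrix (Fin m ⊕ Fin m) (Fin n ⊕ Fin n) ℝ)
    (D : Matrix (Fin m ⊕ Fin m) (Fin m ⊕ Fin m) ℝ)
    (hreal : PhysRealQuad A B C D) :
    ∀ s : ℂ, 0 ≤ s.re →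
      IsUnit (s • (1 : Matrix (Fin n ⊕ Fin n) (Fin n ⊕ Fin n) ℂ) - toC A) →
      IsUnit ((-(starRingEnd ℂ s)) • (1 : Matrix (Fin n ⊕ Fin n) (Fin n ⊕ Fin n) ℂ) - toC A) →
      (toC C * (s • (1 : Matrix (Fin n ⊕ Fin n) (Fin n ⊕ Fin n) ℂ) - toC A)⁻¹ * toC B + toC D) *
          toC (Jt m) *
          (toC C * ((-(starRingEnd ℂ s)) • (1 : Matrix (Fin n ⊕ Fin n) (Fin n ⊕ Fin n) ℂ) -
              toC A)⁻¹ * toC B + toC D)ᴴ =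
        toC (Jt m) := by
  intro s _ hX hY
  obtain ⟨Θ, hBB, hBD, hDB, hDD⟩ := hreal.exists_lyapunov
  simp only [conjTranspose_add, conjTranspose_mul, conjTranspose_nonsing_inv,
    toC_conjTranspose, ← Matrix.mul_assoc]
  refine transfer_mul_transfer (Θ := toC Θ) hX hY.star ?_ ?_ ?_ ?_
  · rw [← toC_mul, ← toC_mul, hBB]
    simp only [conjTranspose_sub, conjTranspose_smul, conjTranspose_one, toC_conjTranspose,
      toC_neg, toC_add, toC_mul, Matrix.sub_mul, Matrix.mul_sub, Matrix.smul_mul,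
      Matrix.mul_smul, Matrix.one_mul, Matrix.mul_one, star_neg, starRingEnd_apply, star_star]
    module
  · simp only [← toC_mul, ← toC_neg, hBD]
  · simp only [← toC_mul, ← toC_neg, hDB]
  · simp only [← toC_mul, hDD]
end
end
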